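/- arXiv:2511.19691 — 4 statements merged into one kernel-verified Lean document; each statement's English description precedes it below -/
import Mathlib

section
/- Let r_L : ℝ → ℝ^d be a continuously differentiable curve and let δ ≥ 0, ε ≥ 0. Suppose r_L satisfies the ε-margin property: for all path parameters a, b ∈ ℝ and all offsets τ ≥ 0, if the arc length d(a,b) ≥ δ + ε then ‖r_L(a + τ) − r_L(b + τ)‖ ≥ δ. Suppose agent i joins the path at time t_i at parameter t_{Li} (so r_i(t) = r_L(t_{Li} + (t − t_i)) for t ≥ t_i) and agent j joins at time t_j at parameter t_{Lj} (so r_j(t) = r_L(t_{Lj} + (t − t_j)) for t ≥ t_j). Let t_c = max(t_i, t_j), a = t_{Li} + (t_c − t_i), and b = t_{Lj} + (t_c − t_j). If the Euclidean (chord) distance satisfies ‖r_L(a) − r_L(b)‖ ≥ δ + ε, then ‖r_i(t) − r_j(t)‖ ≥ δ for all t ≥ t_c. (The Euclidean condition is a sufficient condition because the arc length between two parameters is always at least the Euclidean distance between the corresponding points.) -/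
/-- Arc length of a curve `rL` between parameters `a` and `b`:
`∫ τ in [min a b, max a b], ‖rL'(τ)‖`. -/
noncomputable def arcLen {d : ℕ} (rL : ℝ → EuclideanSpace ℝ (Fin d)) (a b : ℝ) : ℝ :=
  ∫ τ in min a b..max a b, ‖deriv rL τ‖

/-- The chord between two points of a continuously differentiable curve is no longer than
the arc joining them. -/
theorem norm_sub_le_arcLen {d : ℕ} {rL : ℝ → EuclideanSpace ℝ (Fin d)}
    (hC1 : ContDiff ℝ 1 rL) (a b : ℝ) : ‖rL a - rL b‖ ≤ arcLen rL a b := by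
  have hcont : Continuous (deriv rL) := hC1.continuous_deriv le_rfl
  have hle : min a b ≤ max a b := min_le_max
  have hftc : ∫ τ in min a b..max a b, deriv rL τ = rL (max a b) - rL (min a b) :=
    intervalIntegral.integral_deriv_eq_sub
      (fun x _ => (hC1.differentiable one_ne_zero).differentiableAt)
      (hcont.intervalIntegrable _ _)
  have hnorm : ‖rL a - rL b‖ = ‖rL (max a b) - rL (min a b)‖ := by
    rcases le_total a b with h | h
    · rw [max_eq_right h, min_eq_left h, norm_sub_rev]
    · rw [max_eq_left h, min_eq_right h]
  rw [hnorm, ← hftc]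
  exact intervalIntegral.norm_integral_le_integral_norm hle

/-- **Euclidean (chord) sufficient condition for backup-set validity.**
If the leader curve `rL` satisfies the `ε`-margin property (stated with arc length) and
the chord distance between the two agents' join points at time `t_c = max t_i t_j` is
at least `δ + ε`, then the agents remain `δ`-separated for all `t ≥ t_c`.  (Sufficiency
holds because arc length dominates chord length.) -/
theorem multi_agent_gatekeeper_backup_set_validity_euclidean
    {d : ℕ} (rL : ℝ → EuclideanSpace ℝ (Fin d))
    (δ ε : ℝ) (hδ : 0 ≤ δ) (hε : 0 ≤ ε)
    (hC1 : ContDiff ℝ 1 rL)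
    (hmargin : ∀ a b τ : ℝ, 0 ≤ τ → δ + ε ≤ arcLen rL a b →
      δ ≤ ‖rL (a + τ) - rL (b + τ)‖)
    (ri rj : ℝ → EuclideanSpace ℝ (Fin d))
    (ti tj tLi tLj : ℝ)
    (hi : ∀ t, ti ≤ t → ri t = rL (tLi + (t - ti)))
    (hj : ∀ t, tj ≤ t → rj t = rL (tLj + (t - tj)))
    (tc a b : ℝ) (htc : tc = max ti tj)
    (ha : a = tLi + (tc - ti)) (hb : b = tLj + (tc - tj))
    (hchord : δ + ε ≤ ‖rL a - rL b‖) :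
    ∀ t, tc ≤ t → δ ≤ ‖ri t - rj t‖ := by
  intro t ht
  have hti : ti ≤ t := (le_max_left ti tj).trans (htc ▸ ht)
  have htj : tj ≤ t := (le_max_right ti tj).trans (htc ▸ ht)
  have hsep := hmargin a b (t - tc) (sub_nonneg.mpr ht)
    (hchord.trans (norm_sub_le_arcLen hC1 a b))
  have hai : a + (t - tc) = tLi + (t - ti) := by rw [ha]; ring
  have hbj : b + (t - tc) = tLj + (t - tj) := by rw [hb]; ring
  rwa [hai, hbj, ← hi t hti, ← hj t htj] at hsep
end

section
/- (Correctness of the inter-agent validation check.) Let r_L : ℝ → ℝ^d be a continuously differentiable curve satisfying the ε-margin property for given δ ≥ 0, ε ≥ 0. Let r_i, r_j : ℝ → ℝ^d be the position trajectories of two agents, and let t_k ≤ t_max be times such that: (1) ‖r_i(t) − r_j(t)‖ ≥ δ for all t ∈ [t_k, t_max); (2) there exist path parameters a and b with r_i(t) = r_L(a + (t − t_max)) and r_j(t) = r_L(b + (t − t_max)) for all t ≥ t_max; and (3) ‖r_i(t_max) − r_j(t_max)‖ ≥ δ + ε. Then ‖r_i(t) − r_j(t)‖ ≥ δ for all t ≥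 t_k. -/
/-- **Correctness of the inter-agent validation check (Algorithm 3).**
If two agents are `δ`-separated on `[t_k, t_max)`, both travel along the leader curve
`rL` (which satisfies the `ε`-margin property) from time `t_max` onward, and their
positions at `t_max` are separated by at least `δ + ε`, then they remain `δ`-separated
for all `t ≥ t_k`. -/
theorem validate_candidate_inter_agent_correct
    {d : ℕ} (rL : ℝ → EuclideanSpace ℝ (Fin d))
    (δ ε : ℝ) (hδ : 0 ≤ δ) (hε : 0 ≤ ε)
    (hC1 : ContDiff ℝ 1 rL)
    (hmargin : ∀ a b τ : ℝ, 0 ≤ τ → δ + ε ≤ arcLen rL a b →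
      δ ≤ ‖rL (a + τ) - rL (b + τ)‖)
    (ri rj : ℝ → EuclideanSpace ℝ (Fin d))
    (tk tmax : ℝ) (htk : tk ≤ tmax)
    (htransition : ∀ t, tk ≤ t → t < tmax → δ ≤ ‖ri t - rj t‖)
    (honpath : ∃ a b : ℝ,
      (∀ t, tmax ≤ t → ri t = rL (a + (t - tmax))) ∧
      (∀ t, tmax ≤ t → rj t = rL (b + (t - tmax))))
    (hslot : δ + ε ≤ ‖ri tmax - rj tmax‖) :
    ∀ t, tk ≤ t → δ ≤ ‖ri t - rj t‖ := by
  intro t ht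
  rcases lt_or_ge t tmax with h | h
  · exact htransition t ht h
  · obtain ⟨a, b, hi, hj⟩ := honpath
    rw [hi t h, hj t h]
    refine hmargin a b _ (sub_nonneg.mpr h) (hslot.trans ?_)
    rw [hi tmax le_rfl, hj tmax le_rfl, sub_self, add_zero, add_zero]
    exact norm_sub_le_arcLen hC1 a b
end

section
/- (Inductive invariant of the multi-agent gatekeeper commit rule.) Let N ≥ 1 agents be indexed by Fin N, let S ⊆ ℝ^n be a safe set, let δ > 0, and let σ : ℕ → ℝ be a monotone nondecreasing sequence of event times. Let P : ℕ → Fin N → (ℝ → ℝ^n) assign to each event index m a committed trajectory for each agent, and let a : ℕ → Fin N designate the unique agent that updates at each event m ≥ 1, i.e., P m j = P (m−1) j for all j ≠ a(m). Say a profile P m is 'valid at time t' if for every agent i and every s ≥ t, (P m i) s ∈ S, and for every pair of distinct agents i ≠ j and every s ≥ t, ‖(P m i) s − (P m j) s‖ ≥ δ. Assume: (i) P 0 is valid at time σ(0); (ii) for every m ≥ 1, either P m (a m) = P (m−1) (a m), or the new trajectory q = P m (a m) satisfies q(s) ∈ S for all s ≥ σ(m) and ‖q(s) − (P (m−1) j)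 s‖ ≥ δ for all j ≠ a(m) and all s ≥ σ(m). Then for every m, the profile P m is valid at time σ(m). -/
/-- A profile of committed trajectories `P : Fin N → (ℝ → ℝⁿ)` is *valid at time `t`*
if from time `t` onward every committed trajectory lies in the safe set `S` and every
two distinct agents' trajectories are separated by at least `δ`. -/
def ValidProfile {n N : ℕ} (S : Set (EuclideanSpace ℝ (Fin n))) (δ : ℝ)
    (P : Fin N → ℝ → EuclideanSpace ℝ (Fin n)) (t : ℝ) : Prop :=
  (∀ i : Fin N, ∀ s, t ≤ s → P i s ∈ S) ∧
  (∀ i j : Fin N, i ≠ j → ∀ s, t ≤ s → δ ≤ ‖P i s - P j s‖)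

theorem ValidProfile.mono {n N : ℕ} {S : Set (EuclideanSpace ℝ (Fin n))} {δ : ℝ}
    {P : Fin N → ℝ → EuclideanSpace ℝ (Fin n)} {t t' : ℝ} (h : ValidProfile S δ P t)
    (ht : t ≤ t') : ValidProfile S δ P t' :=
  ⟨fun i s hs => h.1 i s (ht.trans hs), fun i j hij s hs => h.2 i j hij s (ht.trans hs)⟩

/-- Replacing one agent's trajectory by one that is safe and separated from all the others
preserves validity. -/
theorem ValidProfile.commit {n N : ℕ} {S : Set (EuclideanSpace ℝ (Fin n))} {δ : ℝ}
    {P Q : Fin N → ℝ → EuclideanSpace ℝ (Fin n)} {t : ℝ} {b : Fin N}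
    (h : ValidProfile S δ P t) (hother : ∀ j, j ≠ b → Q j = P j)
    (hsafe : ∀ s, t ≤ s → Q b s ∈ S)
    (hsep : ∀ j, j ≠ b → ∀ s, t ≤ s → δ ≤ ‖Q b s - P j s‖) : ValidProfile S δ Q t := by
  refine ⟨fun i s hs => ?_, fun i j hij s hs => ?_⟩
  · by_cases hi : i = b
    · exact hi ▸ hsafe s hs
    · exact hother i hi ▸ h.1 i s hs
  · by_cases hi : i = b
    · subst hi
      rw [hother j hij.symm]
      exact hsep j hij.symm s hs
    · rw [hother i hi]
      by_cases hj : j = b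
      · subst hj
        rw [norm_sub_rev]
        exact hsep i hij s hs
      · rw [hother j hj]
        exact h.2 i j hij s hs

/-- **Inductive invariant of the multi-agent gatekeeper commit rule.**
If the initial profile is valid at `σ 0`, and at each event `m ≥ 1` the unique updating
agent `a m` either keeps its previous committed trajectory or commits a new one that is
safe and `δ`-separated from all other agents' previous committed trajectories for all
`s ≥ σ m`, then the profile at every event `m` is valid at time `σ m`. -/
theorem multi_agent_gatekeeper_inductive_invariant
    {n N : ℕ} (hN : 1 ≤ N)
    (S : Set (EuclideanSpace ℝ (Fin n))) (δ : ℝ) (hδ : 0 < δ)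
    (σ : ℕ → ℝ) (hσ : Monotone σ)
    (P : ℕ → Fin N → ℝ → EuclideanSpace ℝ (Fin n))
    (a : ℕ → Fin N)
    (hothers : ∀ m : ℕ, 1 ≤ m → ∀ j : Fin N, j ≠ a m → P m j = P (m - 1) j)
    (hcommit : ∀ m : ℕ, 1 ≤ m →
      P m (a m) = P (m - 1) (a m) ∨
      ((∀ s, σ m ≤ s → P m (a m) s ∈ S) ∧
       (∀ j : Fin N, j ≠ a m → ∀ s, σ m ≤ s → δ ≤ ‖P m (a m) s - P (m - 1) j s‖)))
    (hinit : ValidProfile S δ (P 0) (σ 0)) :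
    ∀ m : ℕ, ValidProfile S δ (P m) (σ m) := by
  intro m
  induction m with
  | zero => exact hinit
  | succ k ih =>
    have hk : ValidProfile S δ (P k) (σ (k + 1)) := ih.mono (hσ k.le_succ)
    have hother : ∀ j, j ≠ a (k + 1) → P (k + 1) j = P k j := hothers (k + 1) k.succ_pos
    rcases hcommit (k + 1) k.succ_pos with hkeep | ⟨hsafe, hsep⟩
    · have hP : P (k + 1) = P k := by
        funext j
        by_cases hj : j = a (k + 1)
        · exact hj ▸ hkeep
        · exact hother j hj
      exact hP ▸ hk
    · exact hk.commit hother hsafe hsep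
end

section
/- (Safety of multi-agent gatekeeper, Theorem 1.) Let N ≥ 1 agents be indexed by Fin N, let S ⊆ ℝ^n be a safe set, let δ > 0, and let σ : ℕ → ℝ be a strictly increasing sequence of event times with σ(m) → ∞ as m → ∞ and σ(0) = t_0. Let P : ℕ → Fin N → (ℝ → ℝ^n) and a : ℕ → Fin N be as follows: for each m ≥ 1, P m j = P (m−1) j for all j ≠ a(m), and either P m (a m) = P (m−1) (a m) or the new trajectory q = P m (a m) satisfies q(s) ∈ S for all s ≥ σ(m) and ‖q(s) − (P (m−1) j) s‖ ≥ δ for all j ≠ a(m) and all s ≥ σ(m). Assume P 0 is valid at time σ(0), i.e., (P 0 i) s ∈ S and ‖(P 0 i) s − (P 0 j) s‖ ≥ δ for all i ≠ j and all s ≥ σ(0). Define the executed trajectory of agent i by x_i(t) = (P (m(t)) i) t, where m(t) is the largest m with σ(m) ≤ t (well-defined since σ is strictly increasing and tends to infinity). Then for every t ≥ t_0 and every agent i, x_i(t) ∈ S, and for all distinct agents i ≠ j, ‖x_i(t) − x_j(t)‖ ≥ δ. -/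
open Filter

/-- Index of the most recent planning event at time `t`: the largest `m` with
`σ m ≤ t` (for `σ` strictly increasing and tending to infinity, and `t ≥ σ 0`,
the set `{m | σ m ≤ t}` is nonempty and bounded above, so this `sSup` is the
genuine maximum). -/
noncomputable def execIdx (σ : ℕ → ℝ) (t : ℝ) : ℕ :=
  sSup {m : ℕ | σ m ≤ t}

/-- The most recent event time at `t` is at most `t`. -/
theorem map_execIdx_le {σ : ℕ → ℝ} (hσtop : Tendsto σ atTop atTop) {t : ℝ} (ht : σ 0 ≤ t) :
    σ (execIdx σ t) ≤ t := by
  obtain ⟨M, hM⟩ := eventually_atTop.1 (hσtop.eventually_gt_atTop t)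
  have hbdd : BddAbove {m : ℕ | σ m ≤ t} :=
    ⟨M, fun m hm => le_of_not_gt fun h => (hM m h.le).not_ge hm⟩
  exact Nat.sSup_mem ⟨0, ht⟩ hbdd

/-- The profile `p` is valid at time `t`: from `t` onward, all trajectories lie in `S` and
are pairwise `δ`-separated. -/
def ValidAt {ι E : Type*} [NormedAddCommGroup E] (S : Set E) (δ : ℝ) (p : ι → ℝ → E)
    (t : ℝ) : Prop :=
  (∀ i, ∀ s, t ≤ s → p i s ∈ S) ∧ ∀ i j, i ≠ j → ∀ s, t ≤ s → δ ≤ ‖p i s - p j s‖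

namespace ValidAt

variable {ι E : Type*} [NormedAddCommGroup E] {S : Set E} {δ t t' : ℝ} {p q : ι → ℝ → E}

/-- A valid profile stays valid at later times. -/
theorem mono (h : ValidAt S δ p t) (htt' : t ≤ t') : ValidAt S δ p t' :=
  ⟨fun i s hs => h.1 i s (htt'.trans hs), fun i j hij s hs => h.2 i j hij s (htt'.trans hs)⟩

/-- Validity is preserved when a single agent retains its trajectory or commits one that is safe
and separated from those of the other agents. -/
theorem commit (h : ValidAt S δ p t) {k : ι} (hothers : ∀ j, j ≠ k → q j = p j)
    (hcommit : q k = p k ∨ ((∀ s, t ≤ s → q k s ∈ S) ∧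
      ∀ j, j ≠ k → ∀ s, t ≤ s → δ ≤ ‖q k s - p j s‖)) :
    ValidAt S δ q t := by
  rcases hcommit with hk | ⟨hsafe, hsep⟩
  · have hqp : q = p := by
      funext j
      by_cases hj : j = k
      · rw [hj, hk]
      · exact hothers j hj
    rwa [hqp]
  · refine ⟨fun i s hs => ?_, fun i j hij s hs => ?_⟩
    · by_cases hi : i = k
      · exact hi ▸ hsafe s hs
      · exact hothers i hi ▸ h.1 i s hs
    · by_cases hi : i = k
      · subst hi
        rw [hothers j hij.symm]
        exact hsep j hij.symm s hs
      · by_cases hj : j = k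
        · subst hj
          rw [hothers i hi, norm_sub_rev]
          exact hsep i hi s hs
        · rw [hothers i hi, hothers j hj]
          exact h.2 i j hij s hs

end ValidAt

/-- **Safety of multi-agent gatekeeper (Theorem 1).**
Under the gatekeeper commit rule — exactly one agent updates at each event, committing
a new trajectory only if it is safe and `δ`-separated from all other agents' committed
trajectories for all future time — if the initial committed profile is valid at
`t₀ = σ 0`, then the executed trajectories `xᵢ(t) = (P (m(t)) i) t`, following the most
recently committed profile, remain in the safe set and pairwise `δ`-separated for all
`t ≥ t₀`. -/
theorem multi_agent_gatekeeper_safety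
    {n N : ℕ} (hN : 1 ≤ N)
    (S : Set (EuclideanSpace ℝ (Fin n))) (δ : ℝ) (hδ : 0 < δ)
    (σ : ℕ → ℝ) (hσ : StrictMono σ) (hσtop : Tendsto σ atTop atTop)
    (t₀ : ℝ) (hσ0 : σ 0 = t₀)
    (P : ℕ → Fin N → ℝ → EuclideanSpace ℝ (Fin n))
    (a : ℕ → Fin N)
    (hothers : ∀ m : ℕ, 1 ≤ m → ∀ j : Fin N, j ≠ a m → P m j = P (m - 1) j)
    (hcommit : ∀ m : ℕ, 1 ≤ m →
      P m (a m) = P (m - 1) (a m) ∨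
      ((∀ s, σ m ≤ s → P m (a m) s ∈ S) ∧
       (∀ j : Fin N, j ≠ a m → ∀ s, σ m ≤ s → δ ≤ ‖P m (a m) s - P (m - 1) j s‖)))
    (hinit : (∀ i : Fin N, ∀ s, σ 0 ≤ s → P 0 i s ∈ S) ∧
      (∀ i j : Fin N, i ≠ j → ∀ s, σ 0 ≤ s → δ ≤ ‖P 0 i s - P 0 j s‖))
    (x : Fin N → ℝ → EuclideanSpace ℝ (Fin n))
    (hx : ∀ (i : Fin N) (t : ℝ), x i t = P (execIdx σ t) i t) :
    ∀ t, t₀ ≤ t →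
      (∀ i : Fin N, x i t ∈ S) ∧
      (∀ i j : Fin N, i ≠ j → δ ≤ ‖x i t - x j t‖) := by
  have hvalid : ∀ m, ValidAt S δ (P m) (σ m) := by
    intro m
    induction m with
    | zero => exact hinit
    | succ m ih =>
      exact (ih.mono (hσ m.lt_succ_self).le).commit (hothers (m + 1) m.succ_pos)
        (hcommit (m + 1) m.succ_pos)
  intro t ht
  have hle := map_execIdx_le hσtop (hσ0.trans_le ht)
  simp only [hx]
  exact ⟨fun i => (hvalid _).1 i t hle, fun i j hij => (hvalid _).2 i j hij t hle⟩
end
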